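/- arXiv:2412.00032 — 2 statements merged into one kernel-verified Lean document; each statement's English description precedes it below -/
import Mathlib

section
/- Let F be an algebraically closed field, f(ξ) ∈ F[ξ] a nonzero polynomial with zero constant term, and γ ∈ F. For x in the split octonion algebra O over F, the equation f(x) = γ·1 holds if and only if one of the following holds: (i) there exists ξ₁ ∈ F with f(ξ₁) = γ and x = ξ₁·1; (ii) there exist ξ₁ ≠ ξ₂ in F with f(ξ₁) = f(ξ₂) = γ and an F-algebra automorphism g of O with x = g(ξ₁·e₁ + ξ₂·e₂); (iii) there exist ξ₁ ∈ F with f(ξ₁) = γ and f′(ξ₁) = 0 and an F-algebra automorphism g of O with x = g(ξ₁·1 + u₁). -/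
noncomputable section

/-- The split octonion algebra over `F`, given by Zorn vector matrices
`(x1, u; v, x2)` with `x1, x2 ∈ F` and `u, v ∈ F³`. -/
@[ext]
structure SplitOctonion (F : Type*) where
  x1 : F
  u : Fin 3 → F
  v : Fin 3 → F
  x2 : F

namespace SplitOctonion

variable {F : Type*} [Field F]

/-- Dot product on `F³`. -/
def dot (x y : Fin 3 → F) : F := x 0 * y 0 + x 1 * y 1 + x 2 * y 2

/-- Cross product on `F³`. -/
def cross (x y : Fin 3 → F) : Fin 3 → F :=
  ![x 1 * y 2 - x 2 * y 1, x 2 * y 0 - x 0 * y 2, x 0 * y 1 - x 1 * y 0]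

instance : Zero (SplitOctonion F) := ⟨⟨0, 0, 0, 0⟩⟩
instance : One (SplitOctonion F) := ⟨⟨1, 0, 0, 1⟩⟩
instance : Add (SplitOctonion F) :=
  ⟨fun x y => ⟨x.x1 + y.x1, x.u + y.u, x.v + y.v, x.x2 + y.x2⟩⟩
instance : Neg (SplitOctonion F) := ⟨fun x => ⟨-x.x1, -x.u, -x.v, -x.x2⟩⟩
instance : SMul F (SplitOctonion F) :=
  ⟨fun c x => ⟨c * x.x1, c • x.u, c • x.v, c * x.x2⟩⟩

/-- Zorn vector matrix multiplication. -/
instance : Mul (SplitOctonion F) :=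
  ⟨fun x y => ⟨x.x1 * y.x1 + dot x.u y.v,
    x.x1 • y.u + y.x2 • x.u - cross x.v y.v,
    y.x1 • x.v + x.x2 • y.v + cross x.u y.u,
    x.x2 * y.x2 + dot x.v y.u⟩⟩

@[simp] lemma zero_x1 : (0 : SplitOctonion F).x1 = 0 := rfl
@[simp] lemma zero_u : (0 : SplitOctonion F).u = 0 := rfl
@[simp] lemma zero_v : (0 : SplitOctonion F).v = 0 := rfl
@[simp] lemma zero_x2 : (0 : SplitOctonion F).x2 = 0 := rfl
@[simp] lemma add_x1 (x y : SplitOctonion F) : (x + y).x1 = x.x1 + y.x1 := rfl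
@[simp] lemma add_u (x y : SplitOctonion F) : (x + y).u = x.u + y.u := rfl
@[simp] lemma add_v (x y : SplitOctonion F) : (x + y).v = x.v + y.v := rfl
@[simp] lemma add_x2 (x y : SplitOctonion F) : (x + y).x2 = x.x2 + y.x2 := rfl
@[simp] lemma neg_x1 (x : SplitOctonion F) : (-x).x1 = -x.x1 := rfl
@[simp] lemma neg_u (x : SplitOctonion F) : (-x).u = -x.u := rfl
@[simp] lemma neg_v (x : SplitOctonion F) : (-x).v = -x.v := rfl
@[simp] lemma neg_x2 (x : SplitOctonion F) : (-x).x2 = -x.x2 := rfl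
@[simp] lemma smul_x1 (c : F) (x : SplitOctonion F) : (c • x).x1 = c * x.x1 := rfl
@[simp] lemma smul_u (c : F) (x : SplitOctonion F) : (c • x).u = c • x.u := rfl
@[simp] lemma smul_v (c : F) (x : SplitOctonion F) : (c • x).v = c • x.v := rfl
@[simp] lemma smul_x2 (c : F) (x : SplitOctonion F) : (c • x).x2 = c * x.x2 := rfl

instance : AddCommGroup (SplitOctonion F) where
  add_assoc x y z := by ext <;> simp [add_assoc]
  zero_add x := by ext <;> simp
  add_zero x := by ext <;> simp
  add_comm x y := by ext <;> simp [add_comm]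
  neg_add_cancel x := by ext <;> simp
  nsmul := nsmulRec
  zsmul := zsmulRec

instance : Module F (SplitOctonion F) where
  one_smul x := by ext <;> simp
  mul_smul c d x := by ext <;> simp [mul_assoc, mul_smul]
  smul_zero c := by ext <;> simp
  smul_add c x y := by ext <;> simp [mul_add, smul_add]
  add_smul c d x := by ext <;> simp [add_mul, add_smul]
  zero_smul x := by ext <;> simp

/-- Powers of a single octonion (well defined by power-associativity). -/
def npow (x : SplitOctonion F) : ℕ → SplitOctonion F
  | 0 => 1
  | n + 1 => npow x n * x

instance : Pow (SplitOctonion F) ℕ := ⟨npow⟩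

/-- Substitution of an octonion into a polynomial over `F`:
`f(x) = αₙ xⁿ + ⋯ + α₁ x + α₀ • 1`. -/
def peval (f : Polynomial F) (x : SplitOctonion F) : SplitOctonion F :=
  f.sum fun i c => c • x ^ i

/-- The octonion `e₁`. -/
def e1 : SplitOctonion F := ⟨1, 0, 0, 0⟩
/-- The octonion `e₂`. -/
def e2 : SplitOctonion F := ⟨0, 0, 0, 1⟩
/-- The octonion `u₁`. -/
def u1 : SplitOctonion F := ⟨0, ![1, 0, 0], 0, 0⟩

/-- Conjugation on `O`. -/
def conj (x : SplitOctonion F) : SplitOctonion F := ⟨x.x2, -x.u, -x.v, x.x1⟩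

/-- The norm of an octonion. -/
def normO (x : SplitOctonion F) : F := x.x1 * x.x2 - dot x.u x.v

/-- The trace of an octonion. -/
def trO (x : SplitOctonion F) : F := x.x1 + x.x2

/-- `g` is an `F`-algebra automorphism of `O`: a linear bijection preserving
multiplication (and the unit). -/
def IsAlgAut (g : SplitOctonion F ≃ₗ[F] SplitOctonion F) : Prop :=
  g 1 = 1 ∧ ∀ x y, g (x * y) = g x * g y

end SplitOctonion

namespace SplitOctonion

variable {F : Type*} [Field F]

lemma mul_x1 (x y : SplitOctonion F) : (x * y).x1 = x.x1 * y.x1 + dot x.u y.v := rfl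
lemma mul_u (x y : SplitOctonion F) :
    (x * y).u = x.x1 • y.u + y.x2 • x.u - cross x.v y.v := rfl
lemma mul_v (x y : SplitOctonion F) :
    (x * y).v = y.x1 • x.v + x.x2 • y.v + cross x.u y.u := rfl
lemma mul_x2 (x y : SplitOctonion F) : (x * y).x2 = x.x2 * y.x2 + dot x.v y.u := rfl
lemma one_x1 : (1 : SplitOctonion F).x1 = 1 := rfl
lemma one_u : (1 : SplitOctonion F).u = 0 := rfl
lemma one_v : (1 : SplitOctonion F).v = 0 := rfl
lemma one_x2 : (1 : SplitOctonion F).x2 = 1 := rfl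

lemma cross0 (x y : Fin 3 → F) : cross x y 0 = x 1 * y 2 - x 2 * y 1 := rfl
lemma cross1 (x y : Fin 3 → F) : cross x y 1 = x 2 * y 0 - x 0 * y 2 := rfl
lemma cross2 (x y : Fin 3 → F) : cross x y 2 = x 0 * y 1 - x 1 * y 0 := rfl

lemma ext8 {x y : SplitOctonion F} (h1 : x.x1 = y.x1) (h2 : x.x2 = y.x2)
    (a0 : x.u 0 = y.u 0) (a1 : x.u 1 = y.u 1) (a2 : x.u 2 = y.u 2)
    (b0 : x.v 0 = y.v 0) (b1 : x.v 1 = y.v 1) (b2 : x.v 2 = y.v 2) : x = y := by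
  apply SplitOctonion.ext h1 _ _ h2
  · funext i; fin_cases i <;> assumption
  · funext i; fin_cases i <;> assumption

def d1 (a : Fin 3 → F) (x : SplitOctonion F) : SplitOctonion F :=
  ⟨x.x1 - dot a x.v, (x.x1 - x.x2 - dot a x.v) • a + x.u, x.v - cross x.u a, x.x2 + dot a x.v⟩

def d2 (a : Fin 3 → F) (x : SplitOctonion F) : SplitOctonion F :=
  ⟨x.x1 + dot x.u a, x.u + cross x.v a, (-x.x1 + x.x2 - dot x.u a) • a + x.v, x.x2 - dot x.u a⟩

def sw (x : SplitOctonion F) : SplitOctonion F := ⟨x.x2, -x.v, -x.u, x.x1⟩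

def Conj (x y : SplitOctonion F) : Prop :=
  ∃ g : SplitOctonion F ≃ₗ[F] SplitOctonion F, IsAlgAut g ∧ x = g y

lemma Conj.trans {x y z : SplitOctonion F} (h : Conj x y) (h' : Conj y z) : Conj x z := by
  obtain ⟨g, hg, rfl⟩ := h
  obtain ⟨g', hg', rfl⟩ := h'
  exact ⟨g'.trans g, ⟨by simp [hg'.1, hg.1], fun a b => by simp [hg'.2, hg.2]⟩, by simp⟩

lemma Conj.symm {x y : SplitOctonion F} (h : Conj x y) : Conj y x := by
  obtain ⟨g, hg, rfl⟩ := h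
  refine ⟨g.symm, ⟨by rw [LinearEquiv.symm_apply_eq, hg.1], fun a b => ?_⟩, by simp⟩
  rw [LinearEquiv.symm_apply_eq, hg.2]; simp

lemma Conj.refl (x : SplitOctonion F) : Conj x x :=
  ⟨LinearEquiv.refl _ _, ⟨by simp, fun a b => by simp⟩, by simp⟩

lemma Conj.add_smul_one {x y : SplitOctonion F} (h : Conj x y) (c : F) :
    Conj (c • (1 : SplitOctonion F) + x) (c • (1 : SplitOctonion F) + y) := by
  obtain ⟨g, hg, rfl⟩ := h
  exact ⟨g, hg, by simp [hg.1]⟩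

lemma conj_d1 (a : Fin 3 → F) (x : SplitOctonion F) : Conj (d1 a x) x := by
  refine ⟨{ toFun := d1 a, invFun := d1 (-a), map_add' := ?_, map_smul' := ?_, left_inv := ?_, right_inv := ?_ }, ⟨?_, ?_⟩, rfl⟩
  · intro x y; apply ext8 <;> simp [d1, dot, cross0, cross1, cross2] <;> ring
  · intro x y; apply ext8 <;> simp [d1, dot, cross0, cross1, cross2] <;> ring
  · intro x; apply ext8 <;> simp [d1, dot, cross0, cross1, cross2] <;> ring
  · intro x; apply ext8 <;> simp [d1, dot, cross0, cross1, cross2] <;> ring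
  · apply ext8 <;> simp [d1, dot, cross0, cross1, cross2, one_x1, one_x2, one_u, one_v]
  · intro x y; apply ext8 <;> simp only [d1, dot, cross0, cross1, cross2, mul_x1, mul_x2, mul_u, mul_v,
      Pi.add_apply, Pi.sub_apply, Pi.smul_apply, smul_eq_mul, LinearEquiv.coe_mk, LinearMap.coe_mk, AddHom.coe_mk] <;> ring

lemma conj_d2 (a : Fin 3 → F) (x : SplitOctonion F) : Conj (d2 a x) x := by
  refine ⟨{ toFun := d2 a, invFun := d2 (-a), map_add' := ?_, map_smul' := ?_, left_inv := ?_, right_inv := ?_ }, ⟨?_, ?_⟩, rfl⟩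
  · intro x y; apply ext8 <;> simp [d2, dot, cross0, cross1, cross2] <;> ring
  · intro x y; apply ext8 <;> simp [d2, dot, cross0, cross1, cross2] <;> ring
  · intro x; apply ext8 <;> simp [d2, dot, cross0, cross1, cross2] <;> ring
  · intro x; apply ext8 <;> simp [d2, dot, cross0, cross1, cross2] <;> ring
  · apply ext8 <;> simp [d2, dot, cross0, cross1, cross2, one_x1, one_x2, one_u, one_v]
  · intro x y; apply ext8 <;> simp only [d2, dot, cross0, cross1, cross2, mul_x1, mul_x2, mul_u, mul_v,
      Pi.add_apply, Pi.sub_apply, Pi.smul_apply, smul_eq_mul, LinearEquiv.coe_mk, LinearMap.coe_mk, AddHom.coe_mk] <;> ring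

lemma conj_sw (x : SplitOctonion F) : Conj (sw x) x := by
  refine ⟨{ toFun := sw, invFun := sw, map_add' := ?_, map_smul' := ?_, left_inv := ?_, right_inv := ?_ }, ⟨?_, ?_⟩, rfl⟩
  · intro x y; apply ext8 <;> simp [sw] <;> ring
  · intro x y; apply ext8 <;> simp [sw]
  · intro x; apply ext8 <;> simp [sw]
  · intro x; apply ext8 <;> simp [sw]
  · apply ext8 <;> simp [sw, one_x1, one_x2, one_u, one_v]
  · intro x y; apply ext8 <;> simp [sw, dot, cross0, cross1, cross2, mul_x1, mul_x2, mul_u, mul_v] <;> ring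

lemma ne_zero_cases {u : Fin 3 → F} (hu : u ≠ 0) : u 0 ≠ 0 ∨ u 1 ≠ 0 ∨ u 2 ≠ 0 := by
  by_contra! h
  apply hu; funext i; fin_cases i
  · exact h.1
  · exact h.2.1
  · exact h.2.2

lemma exists_dot {u : Fin 3 → F} (hu : u ≠ 0) (c : F) : ∃ w, dot u w = c := by
  rcases ne_zero_cases hu with h | h | h
  · exact ⟨![c / u 0, 0, 0], by simp [dot]; field_simp⟩
  · exact ⟨![0, c / u 1, 0], by simp [dot]; field_simp⟩
  · exact ⟨![0, 0, c / u 2], by simp [dot]; field_simp⟩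

lemma dot_comm' (u v : Fin 3 → F) : dot u v = dot v u := by simp [dot]; ring

lemma exists_cross {u v : Fin 3 → F} (hu : u ≠ 0) (h : dot u v = 0) :
    ∃ a, cross u a = v := by
  simp only [dot] at h
  rcases ne_zero_cases hu with h0 | h0 | h0
  · refine ⟨![0, v 2 / u 0, - v 1 / u 0], ?_⟩
    funext i; fin_cases i <;> simp [cross0, cross1, cross2] <;> field_simp
    linear_combination -h
  · refine ⟨![- v 2 / u 1, 0, v 0 / u 1], ?_⟩
    funext i; fin_cases i <;> simp [cross0, cross1, cross2] <;> field_simp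
    linear_combination -h
  · refine ⟨![v 1 / u 2, - v 0 / u 2, 0], ?_⟩
    funext i; fin_cases i <;> simp [cross0, cross1, cross2] <;> field_simp
    linear_combination -h

lemma d1_norm (a : Fin 3 → F) (x : SplitOctonion F) : normO (d1 a x) = normO x := by
  simp [normO, d1, dot, cross0, cross1, cross2]; ring
lemma d2_norm (a : Fin 3 → F) (x : SplitOctonion F) : normO (d2 a x) = normO x := by
  simp [normO, d2, dot, cross0, cross1, cross2]; ring
lemma d1_tr (a : Fin 3 → F) (x : SplitOctonion F) : trO (d1 a x) = trO x := by
  simp [trO, d1]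
lemma d2_tr (a : Fin 3 → F) (x : SplitOctonion F) : trO (d2 a x) = trO x := by
  simp [trO, d2]

/-- make the first diagonal entry zero -/
lemma exists_x1_zero (x : SplitOctonion F) (hn : normO x = 0) :
    ∃ y, Conj x y ∧ y.x1 = 0 ∧ dot y.u y.v = 0 ∧ y.x2 = trO x := by
  have key : ∀ y : SplitOctonion F, Conj x y → y.x1 = 0 → normO y = 0 → trO y = trO x →
      ∃ y, Conj x y ∧ y.x1 = 0 ∧ dot y.u y.v = 0 ∧ y.x2 = trO x := by
    intro y h1 h2 h3 h4
    refine ⟨y, h1, h2, ?_, ?_⟩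
    · simpa [normO, h2] using h3
    · simpa [trO, h2] using h4
  by_cases hu : x.u = 0
  · by_cases hv : x.v = 0
    · have : x.x1 * x.x2 = 0 := by simpa [normO, hu, dot] using hn
      rcases mul_eq_zero.1 this with h | h
      · exact key x (Conj.refl x) h hn rfl
      · refine key (sw x) (conj_sw x).symm h ?_ ?_
        · simp [normO, sw, hu, hv, h, dot]
        · simp [trO, sw, add_comm]
    · obtain ⟨w, hw⟩ := exists_dot hv x.x1
      refine key (d1 w x) (conj_d1 w x).symm ?_ (by rw [d1_norm, hn]) (d1_tr _ _)
      simp [d1, dot_comm' w, hw]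
  · obtain ⟨w, hw⟩ := exists_dot hu (-x.x1)
    refine key (d2 w x) (conj_d2 w x).symm ?_ (by rw [d2_norm, hn]) (d2_tr _ _)
    simp [d2, hw]

lemma conj_e2 (y : SplitOctonion F) (h1 : y.x1 = 0) (h : dot y.u y.v = 0) (h2 : y.x2 ≠ 0) :
    Conj y (y.x2 • e2) := by
  have a := conj_d2 (-((y.x2)⁻¹ • y.v)) y
  have b := conj_d1 ((y.x2)⁻¹ • y.u) (d2 (-((y.x2)⁻¹ • y.v)) y)
  have e : d1 ((y.x2)⁻¹ • y.u) (d2 (-((y.x2)⁻¹ • y.v)) y) = y.x2 • e2 := by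
    have hd : dot y.u (-((y.x2)⁻¹ • y.v)) = 0 := by
      have : dot y.u (-((y.x2)⁻¹ • y.v)) = -(y.x2)⁻¹ * dot y.u y.v := by simp [dot]; ring
      rw [this, h, mul_zero]
    have e' : d2 (-((y.x2)⁻¹ • y.v)) y = ⟨0, y.u, 0, y.x2⟩ := by
      apply ext8 <;> simp [d2, hd, h1, h2, cross0, cross1, cross2] <;> ring
    rw [e']
    apply ext8 <;> simp [d1, dot, cross0, cross1, cross2, e2, h2] <;> ring
  rw [e] at b
  exact (b.trans a).symm

lemma conj_u_uv (u v : Fin 3 → F) (hu : u ≠ 0) (h : dot u v = 0) :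
    Conj ⟨0, u, v, 0⟩ (⟨0, u, 0, 0⟩ : SplitOctonion F) := by
  obtain ⟨a, ha⟩ := exists_cross (v := -v) hu (by simp [dot] at h ⊢; linear_combination -h)
  have := conj_d1 a (⟨0, u, 0, 0⟩ : SplitOctonion F)
  have e : d1 a (⟨0, u, 0, 0⟩ : SplitOctonion F) = ⟨0, u, v, 0⟩ := by
    apply ext8 <;> simp [d1, dot, ha]
  rwa [e] at this

lemma conj_v_uv (u v : Fin 3 → F) (hv : v ≠ 0) (h : dot u v = 0) :
    Conj ⟨0, u, v, 0⟩ (⟨0, 0, v, 0⟩ : SplitOctonion F) := by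
  obtain ⟨a, ha⟩ := exists_cross (v := u) hv (by rw [dot_comm', h])
  have := conj_d2 a (⟨0, 0, v, 0⟩ : SplitOctonion F)
  have e : d2 a (⟨0, 0, v, 0⟩ : SplitOctonion F) = ⟨0, u, v, 0⟩ := by
    apply ext8 <;> simp [d2, dot, ha]
  rwa [e] at this

lemma conj_u1_of_u (u : Fin 3 → F) (hu : u ≠ 0) : Conj (⟨0, u, 0, 0⟩ : SplitOctonion F) u1 := by
  have : ∃ v : Fin 3 → F, v ≠ 0 ∧ dot u v = 0 ∧ dot ![1, 0, 0] v = 0 := by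
    by_cases h : u 1 = 0
    · exact ⟨![0, 1, 0], fun h => by simpa using congrFun h 1, by simp [dot, h], by simp [dot]⟩
    · exact ⟨![0, u 2, - u 1], fun h' => h (by simpa using congrFun h' 2),
        by simp [dot]; ring, by simp [dot]⟩
  obtain ⟨v, hv, h1, h2⟩ := this
  have hn : (![1, 0, 0] : Fin 3 → F) ≠ 0 := fun h => by simpa using congrFun h 0
  exact (conj_u_uv u v hu h1).symm.trans ((conj_v_uv u v hv h1).trans
    ((conj_v_uv _ v hv h2).symm.trans (conj_u_uv _ v hn h2)))

lemma conj_u1 (y : SplitOctonion F) (h1 : y.x1 = 0) (h : dot y.u y.v = 0) (h2 : y.x2 = 0)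
    (hy : y ≠ 0) : Conj y u1 := by
  have key : ∀ y : SplitOctonion F, y.x1 = 0 → dot y.u y.v = 0 → y.x2 = 0 → y.u ≠ 0 →
      Conj y u1 := by
    rintro ⟨a, u, v, b⟩ h1 h h2 hu
    dsimp at h1 h h2 hu
    subst h1 h2
    exact (conj_u_uv u v hu h).trans (conj_u1_of_u u hu)
  by_cases hu : y.u = 0
  · refine (conj_sw y).symm.trans (key _ h2 (by simp [sw, hu, dot]) h1 ?_)
    intro hv
    apply hy
    have hv : y.v = 0 := by simpa [sw] using hv
    apply SplitOctonion.ext <;> simp [h1, h2, hu, hv]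
  · exact key y h1 h h2 hu

lemma classify [IsAlgClosed F] (x : SplitOctonion F) :
    (∃ c : F, x = c • (1 : SplitOctonion F)) ∨
    (∃ a b : F, a ≠ b ∧ Conj x (a • e1 + b • e2)) ∨
    (∃ a : F, Conj x (a • (1 : SplitOctonion F) + u1)) := by
  obtain ⟨c, hc⟩ : ∃ c : F, c * c - trO x * c + normO x = 0 := by
    obtain ⟨c, hc⟩ := IsAlgClosed.exists_root
      (Polynomial.X ^ 2 + (Polynomial.C (-trO x) * Polynomial.X + Polynomial.C (normO x)))
      (by
        have : (Polynomial.X ^ 2 + (Polynomial.C (-trO x) * Polynomial.X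
          + Polynomial.C (normO x))).degree = 2 := by compute_degree!
        rw [this]; decide)
    refine ⟨c, ?_⟩
    simp only [Polynomial.IsRoot, Polynomial.eval_add, Polynomial.eval_mul, Polynomial.eval_pow,
      Polynomial.eval_X, Polynomial.eval_C] at hc
    linear_combination hc
  obtain ⟨z, hz⟩ : ∃ z : SplitOctonion F, z = -(c • (1 : SplitOctonion F)) + x := ⟨_, rfl⟩
  have hx : x = c • (1 : SplitOctonion F) + z := by rw [hz]; abel
  have hn : normO z = 0 := by
    rw [hz]
    simp [normO, one_x1, one_x2, one_u, one_v, trO] at hc ⊢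
    linear_combination hc
  by_cases h0 : z = 0
  · left; exact ⟨c, by rw [hx, h0, add_zero]⟩
  right
  obtain ⟨y, hy, h1, h2, h3⟩ := exists_x1_zero z hn
  by_cases ht : y.x2 = 0
  · right
    refine ⟨c, ?_⟩
    rw [hx]
    refine (hy.trans (conj_u1 y h1 h2 ht ?_)).add_smul_one c
    rintro rfl
    obtain ⟨g, -, hg⟩ := hy
    exact h0 (by rw [hg, map_zero])
  · left
    refine ⟨c, c + y.x2, by simpa using ht, ?_⟩
    have := (hy.trans (conj_e2 y h1 h2 ht)).add_smul_one c
    rw [← hx] at this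
    convert this using 1
    apply ext8 <;> simp [e1, e2, one_x1, one_x2, one_u, one_v]

lemma pow_zero' (x : SplitOctonion F) : x ^ 0 = 1 := rfl
lemma pow_succ' (x : SplitOctonion F) (n : ℕ) : x ^ (n + 1) = x ^ n * x := rfl

lemma peval_add (f g : Polynomial F) (x : SplitOctonion F) :
    peval (f + g) x = peval f x + peval g x :=
  Polynomial.sum_add_index f g _ (fun i => by simp) (fun i a b => by simp [add_smul])

lemma peval_monomial (n : ℕ) (a : F) (x : SplitOctonion F) :
    peval (Polynomial.monomial n a) x = a • x ^ n :=
  Polynomial.sum_monomial_index a _ (by simp)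

lemma map_pow' (g : SplitOctonion F ≃ₗ[F] SplitOctonion F) (hg : IsAlgAut g)
    (x : SplitOctonion F) (n : ℕ) : g (x ^ n) = (g x) ^ n := by
  induction n with
  | zero => exact hg.1
  | succ n ih => rw [pow_succ', hg.2, ih, pow_succ']

lemma peval_map (g : SplitOctonion F ≃ₗ[F] SplitOctonion F) (hg : IsAlgAut g)
    (x : SplitOctonion F) (f : Polynomial F) : peval f (g x) = g (peval f x) := by
  induction f using Polynomial.induction_on' with
  | add p q hp hq => rw [peval_add, peval_add, hp, hq, map_add]
  | monomial n a => rw [peval_monomial, peval_monomial, map_smul, map_pow' g hg]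

lemma peval_diag (a b : F) (f : Polynomial F) :
    peval f (a • e1 + b • e2) = f.eval a • e1 + f.eval b • (e2 : SplitOctonion F) := by
  have hp : ∀ n : ℕ, (a • e1 + b • e2 : SplitOctonion F) ^ n = a ^ n • e1 + b ^ n • e2 := by
    intro n
    induction n with
    | zero => rw [pow_zero']; apply ext8 <;> simp [e1, e2, one_x1, one_x2, one_u, one_v]
    | succ n ih =>
      rw [pow_succ', ih]
      apply ext8 <;> simp [e1, e2, mul_x1, mul_x2, mul_u, mul_v, dot, cross0, cross1, cross2] <;> ring
  induction f using Polynomial.induction_on' with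
  | add p q hp hq => rw [peval_add, hp, hq, Polynomial.eval_add, Polynomial.eval_add]; module
  | monomial n c =>
    rw [peval_monomial, hp, Polynomial.eval_monomial, Polynomial.eval_monomial]; module

lemma peval_scalar (a : F) (f : Polynomial F) :
    peval f (a • (1 : SplitOctonion F)) = f.eval a • (1 : SplitOctonion F) := by
  have h : ∀ c : F, c • (1 : SplitOctonion F) = c • e1 + c • e2 := by
    intro c; apply ext8 <;> simp [e1, e2, one_x1, one_x2, one_u, one_v]
  rw [h, peval_diag, ← h]

lemma peval_nilp (a : F) (f : Polynomial F) :
    peval f (a • (1 : SplitOctonion F) + u1) =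
      f.eval a • (1 : SplitOctonion F) + (Polynomial.derivative f).eval a • u1 := by
  have hp : ∀ n : ℕ, (a • (1 : SplitOctonion F) + u1) ^ n =
      a ^ n • (1 : SplitOctonion F) + ((n : F) * a ^ (n - 1)) • u1 := by
    intro n
    induction n with
    | zero => rw [pow_zero']; simp
    | succ n ih =>
      rw [pow_succ', ih]
      have : (n : F) * a ^ (n - 1) * a = n * a ^ n := by
        cases n with
        | zero => simp
        | succ n => simp [pow_succ, mul_assoc]
      apply ext8 <;>
        simp [u1, one_x1, one_x2, one_u, one_v, mul_x1, mul_x2, mul_u, mul_v, dot, cross0, cross1, cross2] <;>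
        first | ring1 | linear_combination this | linear_combination -this
  induction f using Polynomial.induction_on' with
  | add p q hp hq =>
    rw [peval_add, hp, hq, Polynomial.derivative_add, Polynomial.eval_add, Polynomial.eval_add]
    module
  | monomial n c =>
    rw [peval_monomial, hp, Polynomial.derivative_monomial, Polynomial.eval_monomial,
      Polynomial.eval_monomial]
    module

lemma aut_eq_iff (g : SplitOctonion F ≃ₗ[F] SplitOctonion F) (hg : IsAlgAut g)
    (y : SplitOctonion F) (c : F) :
    g y = c • (1 : SplitOctonion F) ↔ y = c • (1 : SplitOctonion F) := by
  rw [← g.injective.eq_iff (a := y) (b := c • 1), map_smul, hg.1]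

end SplitOctonion

open SplitOctonion Polynomial in
/-- solutions of `f(x) = γ·1` over the split octonions. -/
theorem peval_eq_smul_one_iff {F : Type*} [Field F] [IsAlgClosed F]
    (f : Polynomial F) (hf : f ≠ 0) (hf0 : f.coeff 0 = 0) (γ : F) (x : SplitOctonion F) :
    peval f x = γ • (1 : SplitOctonion F) ↔
      (∃ ξ₁ : F, f.eval ξ₁ = γ ∧ x = ξ₁ • (1 : SplitOctonion F)) ∨
      (∃ ξ₁ ξ₂ : F, ξ₁ ≠ ξ₂ ∧ f.eval ξ₁ = γ ∧ f.eval ξ₂ = γ ∧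
        ∃ g : SplitOctonion F ≃ₗ[F] SplitOctonion F, IsAlgAut g ∧
          x = g (ξ₁ • e1 + ξ₂ • e2)) ∨
      (∃ ξ₁ : F, f.eval ξ₁ = γ ∧ (derivative f).eval ξ₁ = 0 ∧
        ∃ g : SplitOctonion F ≃ₗ[F] SplitOctonion F, IsAlgAut g ∧
          x = g (ξ₁ • (1 : SplitOctonion F) + u1)) := by
  constructor
  · intro h
    rcases classify x with ⟨c, rfl⟩ | ⟨a, b, hab, g, hg, rfl⟩ | ⟨a, g, hg, rfl⟩
    · left
      rw [peval_scalar] at h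
      refine ⟨c, ?_, rfl⟩
      simpa [one_x1] using congrArg SplitOctonion.x1 h
    · right; left
      rw [peval_map g hg, aut_eq_iff g hg, peval_diag] at h
      refine ⟨a, b, hab, ?_, ?_, g, hg, rfl⟩
      · simpa [one_x1, e1, e2] using congrArg SplitOctonion.x1 h
      · simpa [one_x2, e1, e2] using congrArg SplitOctonion.x2 h
    · right; right
      rw [peval_map g hg, aut_eq_iff g hg, peval_nilp] at h
      refine ⟨a, ?_, ?_, g, hg, rfl⟩
      · simpa [one_x1, u1] using congrArg SplitOctonion.x1 h
      · simpa [one_u, u1] using congrFun (congrArg SplitOctonion.u h) 0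
  · rintro (⟨c, hc, rfl⟩ | ⟨a, b, hab, ha, hb, g, hg, rfl⟩ | ⟨a, ha, hb, g, hg, rfl⟩)
    · rw [peval_scalar, hc]
    · rw [peval_map g hg, aut_eq_iff g hg, peval_diag, ha, hb]
      apply ext8 <;> simp [e1, e2, one_x1, one_x2, one_u, one_v]
    · rw [peval_map g hg, aut_eq_iff g hg, peval_nilp, ha, hb]
      simp
end
end

section
/- Let F be an algebraically closed field, f(ξ) ∈ F[ξ] a nonzero polynomial with zero constant term, and γ₁ ≠ γ₂ in F. For x in the split octonion algebra O over F, the equation f(x) = γ₁·e₁ + γ₂·e₂ holds if and only if there exist ξ₁, ξ₂ ∈ F with f(ξ₁) = γ₁, f(ξ₂) = γ₂, and x = ξ₁·e₁ + ξ₂·e₂. -/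
noncomputable section

namespace SplitOctonion

lemma aux_pow_succ {F : Type*} [Field F] (x : SplitOctonion F) (n : ℕ) :
    x ^ (n + 1) = x ^ n * x := rfl

lemma aux_pow_lin {F : Type*} [Field F] (x : SplitOctonion F) (n : ℕ) :
    ∃ a b : F, x ^ n = a • x + b • (1 : SplitOctonion F) := by
  induction n with
  | zero => exact ⟨0, 1, by rw [zero_smul, one_smul, zero_add]; rfl⟩
  | succ n ih =>
    obtain ⟨a, b, h⟩ := ih
    refine ⟨a * (x.x1 + x.x2) + b, -a * (x.x1 * x.x2 - dot x.u x.v), ?_⟩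
    rw [aux_pow_succ, h]
    apply SplitOctonion.ext
    · change (a * x.x1 + b * 1) * x.x1 + dot (a • x.u + b • 0) x.v = _ * x.x1 + _ * 1
      simp [dot]; ring
    · change (a * x.x1 + b * 1) • x.u + x.x2 • (a • x.u + b • 0) - cross (a • x.v + b • 0) x.v
        = _ • x.u + _ • 0
      ext i
      fin_cases i <;> simp [cross] <;> ring
    · change x.x1 • (a • x.v + b • 0) + (a * x.x2 + b * 1) • x.v + cross (a • x.u + b • 0) x.u
        = _ • x.v + _ • 0
      ext i
      fin_cases i <;> simp [cross] <;> ring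
    · change (a * x.x2 + b * 1) * x.x2 + dot (a • x.v + b • 0) x.u = _ * x.x2 + _ * 1
      simp [dot]; ring

lemma aux_sum_lin {F : Type*} [Field F] (x : SplitOctonion F) (s : Finset ℕ) (c : ℕ → F) :
    ∃ a b : F, ∑ i ∈ s, c i • x ^ i = a • x + b • (1 : SplitOctonion F) := by
  choose A B h using aux_pow_lin x
  refine ⟨∑ i ∈ s, c i * A i, ∑ i ∈ s, c i * B i, ?_⟩
  rw [Finset.sum_smul, Finset.sum_smul, ← Finset.sum_add_distrib]
  refine Finset.sum_congr rfl fun i _ => ?_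
  rw [h, smul_add, mul_smul, mul_smul]

lemma aux_diag {F : Type*} [Field F] (p q : F) :
    p • (e1 : SplitOctonion F) + q • e2 = ⟨p, 0, 0, q⟩ := by
  ext <;> simp [e1, e2]

lemma aux_pow_diag {F : Type*} [Field F] (p q : F) (n : ℕ) :
    (⟨p, 0, 0, q⟩ : SplitOctonion F) ^ n = p ^ n • (e1 : SplitOctonion F) + q ^ n • e2 := by
  induction n with
  | zero => rw [aux_diag, pow_zero, pow_zero]; rfl
  | succ n ih =>
    rw [aux_pow_succ, ih, aux_diag, aux_diag]
    apply SplitOctonion.ext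
    · change p ^ n * p + dot 0 0 = p ^ (n + 1)
      simp [dot, pow_succ]
    · change p ^ n • (0 : Fin 3 → F) + q • 0 - cross 0 0 = 0
      ext i
      fin_cases i <;> simp [cross]
    · change p • (0 : Fin 3 → F) + q ^ n • 0 + cross 0 0 = 0
      ext i
      fin_cases i <;> simp [cross]
    · change q ^ n * q + dot 0 0 = q ^ (n + 1)
      simp [dot, pow_succ]

lemma aux_peval_diag {F : Type*} [Field F] (f : Polynomial F) (p q : F) :
    peval f (⟨p, 0, 0, q⟩ : SplitOctonion F)
      = f.eval p • (e1 : SplitOctonion F) + f.eval q • e2 := by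
  rw [Polynomial.eval_eq_sum, Polynomial.eval_eq_sum]
  unfold peval Polynomial.sum
  rw [Finset.sum_smul, Finset.sum_smul, ← Finset.sum_add_distrib]
  refine Finset.sum_congr rfl fun i _ => ?_
  beta_reduce
  rw [aux_pow_diag, smul_add, mul_smul, mul_smul]

end SplitOctonion

open SplitOctonion Polynomial in
/-- solutions of `f(x) = γ₁·e₁ + γ₂·e₂` with `γ₁ ≠ γ₂`. -/
theorem peval_eq_diag_iff {F : Type*} [Field F] [IsAlgClosed F]
    (f : Polynomial F) (hf : f ≠ 0) (hf0 : f.coeff 0 = 0) (γ₁ γ₂ : F) (hγ : γ₁ ≠ γ₂)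
    (x : SplitOctonion F) :
    peval f x = γ₁ • (e1 : SplitOctonion F) + γ₂ • e2 ↔
      ∃ ξ₁ ξ₂ : F, f.eval ξ₁ = γ₁ ∧ f.eval ξ₂ = γ₂ ∧
        x = ξ₁ • (e1 : SplitOctonion F) + ξ₂ • e2 := by
  constructor
  · intro h
    obtain ⟨a, b, hab⟩ := aux_sum_lin x f.support f.coeff
    have h2 : a • x + b • (1 : SplitOctonion F) = ⟨γ₁, 0, 0, γ₂⟩ := by
      rw [← hab, ← aux_diag, ← h]; rfl
    have k1 : a * x.x1 + b * 1 = γ₁ := congrArg SplitOctonion.x1 h2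
    have k2 : a * x.x2 + b * 1 = γ₂ := congrArg SplitOctonion.x2 h2
    have k3 : a • x.u + b • 0 = 0 := congrArg SplitOctonion.u h2
    have k4 : a • x.v + b • 0 = 0 := congrArg SplitOctonion.v h2
    have ha : a ≠ 0 := by
      rintro rfl
      apply hγ
      rw [← k1, ← k2]; ring
    have hu : x.u = 0 := by simpa [ha] using k3
    have hv : x.v = 0 := by simpa [ha] using k4
    have hx : x = ⟨x.x1, 0, 0, x.x2⟩ := SplitOctonion.ext rfl hu hv rfl
    rw [hx, aux_peval_diag, aux_diag, aux_diag] at h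
    exact ⟨x.x1, x.x2, congrArg SplitOctonion.x1 h, congrArg SplitOctonion.x2 h,
      by rw [aux_diag]; exact hx⟩
  · rintro ⟨p, q, rfl, rfl, rfl⟩
    rw [aux_diag p q, aux_peval_diag]
end
end
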